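/- For any ring R, l.FFD(R) ≤ l.FGFD(R) and r.FFD(R) ≤ r.FGFD(R), where l.FGFD and r.FGFD denote the left and right finitistic Gorenstein flat dimensions. -/

import Mathlib

/-!
Background definitions for D. Bennis, "Weak Gorenstein global dimensions".

Conventions.  All rings are associative with identity.  A *left* `R`-module is a type with
`[AddCommGroup M] [Module R M]`; a *right* `R`-module is a left module over the opposite ring,
i.e. `[Module Rᵐᵒᵖ M]`.  All "right-handed" notions below are obtained by applying the
corresponding "left-handed" notion to the opposite ring `Rᵐᵒᵖ`.
-/

open MulOpposite

universe u

section Tensor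

variable (S : Type u) [Ring S]

/-- The subgroup of relations defining the tensor product `A ⊗_S M` of a right `S`-module `A`
and a left `S`-module `M` over a (possibly noncommutative) ring `S`. -/
def tensorRels (A : Type u) [AddCommGroup A] [Module Sᵐᵒᵖ A]
    (M : Type u) [AddCommGroup M] [Module S M] :
    AddSubgroup (FreeAbelianGroup (A × M)) :=
  AddSubgroup.closure
    { x | (∃ a₁ a₂ m, x = FreeAbelianGroup.of (a₁ + a₂, m) - FreeAbelianGroup.of (a₁, m) -
            FreeAbelianGroup.of (a₂, m)) ∨
          (∃ a m₁ m₂, x = FreeAbelianGroup.of (a, m₁ + m₂) - FreeAbelianGroup.of (a, m₁) -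
            FreeAbelianGroup.of (a, m₂)) ∨
          (∃ (a : A) (r : S) (m : M), x = FreeAbelianGroup.of (op r • a, m) - FreeAbelianGroup.of (a, r • m)) }

/-- The tensor product `A ⊗_S M` (an abelian group) of a right `S`-module `A` and a left
`S`-module `M` over a (possibly noncommutative) ring `S`. -/
def NTensor (A : Type u) [AddCommGroup A] [Module Sᵐᵒᵖ A]
    (M : Type u) [AddCommGroup M] [Module S M] : Type u :=
  FreeAbelianGroup (A × M) ⧸ tensorRels S A M

instance (A : Type u) [AddCommGroup A] [Module Sᵐᵒᵖ A]
    (M : Type u) [AddCommGroup M] [Module S M] : AddCommGroup (NTensor S A M) :=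
  QuotientAddGroup.Quotient.addCommGroup _

namespace NTensor

variable {S}
variable {A A' : Type u} [AddCommGroup A] [Module Sᵐᵒᵖ A] [AddCommGroup A'] [Module Sᵐᵒᵖ A']
variable {M M' : Type u} [AddCommGroup M] [Module S M] [AddCommGroup M'] [Module S M']

/-- Functoriality of `A ⊗_S −` : the map `A ⊗_S M → A ⊗_S M'` induced by a linear map
`g : M → M'` of left `S`-modules. -/
def rmap (A : Type u) [AddCommGroup A] [Module Sᵐᵒᵖ A] (g : M →ₗ[S] M') :
    NTensor S A M →+ NTensor S A M' :=
  QuotientAddGroup.map (tensorRels S A M) (tensorRels S A M') (FreeAbelianGroup.map (Prod.map id g)) (by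
    simp only [tensorRels]
    refine (AddSubgroup.closure_le _).2 ?_
    rintro x (⟨a₁, a₂, m, rfl⟩ | ⟨a, m₁, m₂, rfl⟩ | ⟨a, r, m, rfl⟩) <;>
      refine SetLike.mem_coe.2 (AddSubgroup.mem_comap.2 (AddSubgroup.subset_closure ?_)) <;>
      simp only [map_sub, map_add, map_smul, FreeAbelianGroup.map_of_apply, Prod.map_apply,
        id_eq, Set.mem_setOf_eq]
    · exact Or.inl ⟨a₁, a₂, g m, rfl⟩
    · exact Or.inr (Or.inl ⟨a, g m₁, g m₂, rfl⟩)
    · exact Or.inr (Or.inr ⟨a, r, g m, rfl⟩))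

/-- Functoriality of `− ⊗_S M` : the map `A ⊗_S M → A' ⊗_S M` induced by a linear map
`f : A → A'` of right `S`-modules. -/
def lmap (M : Type u) [AddCommGroup M] [Module S M] (f : A →ₗ[Sᵐᵒᵖ] A') :
    NTensor S A M →+ NTensor S A' M :=
  QuotientAddGroup.map (tensorRels S A M) (tensorRels S A' M) (FreeAbelianGroup.map (Prod.map f id)) (by
    simp only [tensorRels]
    refine (AddSubgroup.closure_le _).2 ?_
    rintro x (⟨a₁, a₂, m, rfl⟩ | ⟨a, m₁, m₂, rfl⟩ | ⟨a, r, m, rfl⟩) <;>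
      refine SetLike.mem_coe.2 (AddSubgroup.mem_comap.2 (AddSubgroup.subset_closure ?_)) <;>
      simp only [map_sub, map_add, map_smul, FreeAbelianGroup.map_of_apply, Prod.map_apply,
        id_eq, Set.mem_setOf_eq]
    · exact Or.inl ⟨f a₁, f a₂, m, rfl⟩
    · exact Or.inr (Or.inl ⟨f a, m₁, m₂, rfl⟩)
    · exact Or.inr (Or.inr ⟨f a, r, m, rfl⟩))

end NTensor

end Tensor

section Dims

variable (S : Type u) [Ring S]

/-- A left `S`-module `M` is *flat* if tensoring with it preserves injectivity of maps of
right `S`-modules. -/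
def IsFlatMod (M : ModuleCat.{u} S) : Prop :=
  ∀ (A B : Type u) [AddCommGroup A] [Module Sᵐᵒᵖ A] [AddCommGroup B] [Module Sᵐᵒᵖ B]
    (f : A →ₗ[Sᵐᵒᵖ] B), Function.Injective f →
      Function.Injective (NTensor.lmap (↥M) f)

/-- A left `S`-module `M` is *Gorenstein flat* if there is an exact sequence
`⋯ → F (-1) → F 0 → F 1 → ⋯` of flat left `S`-modules with `M ≅ Im (F 0 → F 1)` which stays
exact after applying `I ⊗_S −` for every injective right `S`-module `I`
(a *complete flat resolution*). -/
def IsGorensteinFlat (M : ModuleCat.{u} S) : Prop :=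
  ∃ (F : ℤ → ModuleCat.{u} S) (d : ∀ n : ℤ, ↥(F n) →ₗ[S] ↥(F (n + 1))),
    (∀ n, IsFlatMod S (F n)) ∧
    (∀ n, Function.Exact (d n) (d (n + 1))) ∧
    Nonempty (↥M ≃ₗ[S] ↥(LinearMap.range (d 0))) ∧
    (∀ (I : Type u) [AddCommGroup I] [Module Sᵐᵒᵖ I], Module.Injective Sᵐᵒᵖ I →
      ∀ n, Function.Exact (NTensor.rmap I (d n)) (NTensor.rmap I (d (n + 1))))

/-- `gflatDimLE S n M` means `Gfd_S(M) ≤ n`: there is an exact sequence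
`0 → G_n → ⋯ → G_0 → M → 0` of left `S`-modules with all `G_i` Gorenstein flat. -/
def gflatDimLE : ℕ → ModuleCat.{u} S → Prop
  | 0, M => IsGorensteinFlat S M
  | n + 1, M => ∃ (K G : ModuleCat.{u} S) (ι : ↥K →ₗ[S] ↥G) (π : ↥G →ₗ[S] ↥M),
      Function.Injective ι ∧ Function.Surjective π ∧ Function.Exact ι π ∧
      IsGorensteinFlat S G ∧ gflatDimLE n K

/-- `flatDimLE S n M` means `fd_S(M) ≤ n`: there is an exact sequence
`0 → F_n → ⋯ → F_0 → M → 0` of left `S`-modules with all `F_i` flat. -/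
def flatDimLE : ℕ → ModuleCat.{u} S → Prop
  | 0, M => IsFlatMod S M
  | n + 1, M => ∃ (K F : ModuleCat.{u} S) (ι : ↥K →ₗ[S] ↥F) (π : ↥F →ₗ[S] ↥M),
      Function.Injective ι ∧ Function.Surjective π ∧ Function.Exact ι π ∧
      IsFlatMod S F ∧ flatDimLE n K

/-- `injDimLE S n M` means `id_S(M) ≤ n`: there is an exact sequence
`0 → M → I^0 → ⋯ → I^n → 0` of left `S`-modules with all `I^i` injective. -/
def injDimLE : ℕ → ModuleCat.{u} S → Prop
  | 0, M => Module.Injective S ↥M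
  | n + 1, M => ∃ (I C : ModuleCat.{u} S) (ι : ↥M →ₗ[S] ↥I) (π : ↥I →ₗ[S] ↥C),
      Function.Injective ι ∧ Function.Surjective π ∧ Function.Exact ι π ∧
      Module.Injective S ↥I ∧ injDimLE n C

/-- The Gorenstein flat dimension `Gfd_S(M) ∈ ℕ∞` of a left `S`-module `M`. -/
noncomputable def gflatDim (M : ModuleCat.{u} S) : ℕ∞ :=
  sInf {d : ℕ∞ | ∃ n : ℕ, d = n ∧ gflatDimLE S n M}

/-- The flat dimension `fd_S(M) ∈ ℕ∞` of a left `S`-module `M`. -/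
noncomputable def flatDim (M : ModuleCat.{u} S) : ℕ∞ :=
  sInf {d : ℕ∞ | ∃ n : ℕ, d = n ∧ flatDimLE S n M}

/-- The injective dimension `id_S(M) ∈ ℕ∞` of a left `S`-module `M`. -/
noncomputable def injDim (M : ModuleCat.{u} S) : ℕ∞ :=
  sInf {d : ℕ∞ | ∃ n : ℕ, d = n ∧ injDimLE S n M}

/-- The left weak Gorenstein global dimension
`l.Gwdim(S) = sup { Gfd_S(M) | M a left S-module }`.  The right weak Gorenstein global
dimension of `S` is `gorensteinWeakGlobalDim Sᵐᵒᵖ`. -/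
noncomputable def gorensteinWeakGlobalDim : ℕ∞ :=
  ⨆ M : ModuleCat.{u} S, gflatDim S M

/-- The left weak global dimension `sup { fd_S(M) | M a left S-module }`.  (By a classical
theorem it agrees with `weakGlobalDim Sᵐᵒᵖ`, and the common value is `wdim S`.) -/
noncomputable def weakGlobalDim : ℕ∞ :=
  ⨆ M : ModuleCat.{u} S, flatDim S M

/-- The left finitistic flat dimension
`l.FFD(S) = sup { fd_S(M) | M a left S-module with fd_S(M) < ∞ }`. -/
noncomputable def finitisticFlatDim : ℕ∞ :=
  sSup {d : ℕ∞ | d ≠ ⊤ ∧ ∃ M : ModuleCat.{u} S, flatDim S M = d}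

/-- The left finitistic Gorenstein flat dimension
`l.FGFD(S) = sup { Gfd_S(M) | M a left S-module with Gfd_S(M) < ∞ }`. -/
noncomputable def finitisticGFlatDim : ℕ∞ :=
  sSup {d : ℕ∞ | d ≠ ⊤ ∧ ∃ M : ModuleCat.{u} S, gflatDim S M = d}

/-- A ring `S` is *left GF-closed* if the class of Gorenstein flat left `S`-modules is closed
under extensions.  `S` is right GF-closed iff `Sᵐᵒᵖ` is left GF-closed, and GF-closed if both. -/
def IsGFClosed : Prop :=
  ∀ (A B C : ModuleCat.{u} S) (f : ↥A →ₗ[S] ↥B) (g : ↥B →ₗ[S] ↥C),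
    Function.Injective f → Function.Surjective g → Function.Exact f g →
      IsGorensteinFlat S A → IsGorensteinFlat S C → IsGorensteinFlat S B

/-- A ring `S` is *left coherent* if every finitely generated left ideal of `S` is finitely
presented (as a left `S`-module).  `S` is right coherent iff `Sᵐᵒᵖ` is left coherent. -/
def IsLeftCoherent : Prop :=
  ∀ I : Submodule S S, I.FG → Module.FinitePresentation S ↥I

/-- A ring `S` is *left IF* if every injective left `S`-module is flat.  `S` is right IF iff
`Sᵐᵒᵖ` is left IF, and IF if both. -/
def IsLeftIF : Prop :=
  ∀ E : ModuleCat.{u} S, Module.Injective S ↥E → IsFlatMod S E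

/-- A ring `S` is *left `n`-IF* if `fd_S(E) ≤ n` for every injective left `S`-module `E`.
`S` is right `n`-IF iff `Sᵐᵒᵖ` is left `n`-IF, and `n`-IF if both. -/
def IsLeftNIF (n : ℕ) : Prop :=
  ∀ E : ModuleCat.{u} S, Module.Injective S ↥E → flatDim S E ≤ (n : ℕ∞)

/-- `Ext¹_S(T, K) = 0`, expressed by its standard characterization: every extension of `T`
by `K` (i.e. every short exact sequence `0 → K → X → T → 0`) splits. -/
def Ext1Zero (T K : ModuleCat.{u} S) : Prop :=
  ∀ (X : ModuleCat.{u} S) (ι : ↥K →ₗ[S] ↥X) (π : ↥X →ₗ[S] ↥T),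
    Function.Injective ι → Function.Surjective π → Function.Exact ι π →
      ∃ ρ : ↥X →ₗ[S] ↥K, ρ.comp ι = LinearMap.id

/-- A left `S`-module `K` is *cotorsion* if `Ext¹_S(F, K) = 0` for every flat left
`S`-module `F`. -/
def IsCotorsion (K : ModuleCat.{u} S) : Prop :=
  ∀ F : ModuleCat.{u} S, IsFlatMod S F → Ext1Zero S F K

/-- `Tor₁^S(A, T) = 0` for a right `S`-module `A` and a left `S`-module `T`, expressed by its
standard characterization: for every short exact sequence `0 → K → F → T → 0` of left
`S`-modules with `F` flat, the induced map `A ⊗_S K → A ⊗_S F` is injective. -/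
def Tor1Zero (A : Type u) [AddCommGroup A] [Module Sᵐᵒᵖ A] (T : ModuleCat.{u} S) : Prop :=
  ∀ (K F : ModuleCat.{u} S) (ι : ↥K →ₗ[S] ↥F) (π : ↥F →ₗ[S] ↥T),
    IsFlatMod S F → Function.Injective ι → Function.Surjective π → Function.Exact ι π →
      Function.Injective (NTensor.rmap A ι)

/-- A left `S`-module is *finitely presented* if it admits a presentation with finitely many
generators and relations. -/
abbrev IsFinitelyPresented (M : ModuleCat.{u} S) : Prop :=
  Module.FinitePresentation S ↥M

end Dims

open CategoryTheory CategoryTheory.Abelian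

section CharacterDual

namespace NTensor

variable {S : Type u} [Ring S]
variable {M M' : Type u} [AddCommGroup M] [Module S M] [AddCommGroup M'] [Module S M']
variable {A B : Type u} [AddCommGroup A] [Module Sᵐᵒᵖ A] [AddCommGroup B] [Module Sᵐᵒᵖ B]

/-- The class of `(a, m)` in `A ⊗_S M`. -/
def tmul (a : A) (m : M) : NTensor S A M :=
  QuotientAddGroup.mk (FreeAbelianGroup.of (a, m))

@[simp]
theorem rmap_tmul (g : M →ₗ[S] M') (a : A) (m : M) :
    NTensor.rmap A g (tmul a m) = tmul a (g m) :=
  congrArg QuotientAddGroup.mk (FreeAbelianGroup.map_of_apply (f := Prod.map id g) (a, m))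

@[simp]
theorem lmap_tmul (f : A →ₗ[Sᵐᵒᵖ] B) (a : A) (m : M) :
    NTensor.lmap M f (tmul a m) = tmul (f a) m :=
  congrArg QuotientAddGroup.mk (FreeAbelianGroup.map_of_apply (f := Prod.map f id) (a, m))

theorem addHom_ext {G : Type*} [AddCommGroup G] {h h' : NTensor S A M →+ G}
    (H : ∀ a m, h (tmul a m) = h' (tmul a m)) : h = h' :=
  QuotientAddGroup.addMonoidHom_ext _ (FreeAbelianGroup.lift_ext _ _ fun p => H p.1 p.2)

theorem add_tmul (a a' : A) (m : M) : (tmul (a + a') m : NTensor S A M) = tmul a m + tmul a' m :=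
  sub_eq_zero.1 <| (sub_sub _ _ _).symm.trans <| (QuotientAddGroup.eq_zero_iff _).2 <|
    AddSubgroup.subset_closure (Or.inl ⟨a, a', m, rfl⟩)

theorem tmul_add (a : A) (m m' : M) : (tmul a (m + m') : NTensor S A M) = tmul a m + tmul a m' :=
  sub_eq_zero.1 <| (sub_sub _ _ _).symm.trans <| (QuotientAddGroup.eq_zero_iff _).2 <|
    AddSubgroup.subset_closure (Or.inr (Or.inl ⟨a, m, m', rfl⟩))

theorem smul_tmul (r : S) (a : A) (m : M) :
    (tmul (op r • a) m : NTensor S A M) = tmul a (r • m) :=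
  sub_eq_zero.1 <| (QuotientAddGroup.eq_zero_iff _).2 <|
    AddSubgroup.subset_closure (Or.inr (Or.inr ⟨a, r, m, rfl⟩))

theorem tmul_zero (a : A) : (tmul a 0 : NTensor S A M) = 0 := by
  simpa using tmul_add (S := S) a (0 : M) 0

end NTensor

/-- An additive character vanishing on the kernel of `h` factors through `h`, since `ℚ / ℤ` is
divisible. -/
theorem exists_character_comp_eq {X Y : Type*} [AddCommGroup X] [AddCommGroup Y] (h : X →+ Y)
    (c : X →+ AddCircle (1 : ℚ)) (hc : ∀ x, h x = 0 → c x = 0) :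
    ∃ c' : Y →+ AddCircle (1 : ℚ), c'.comp h = c := by
  obtain ⟨c', hc'⟩ := (Module.Baer.of_divisible (AddCircle (1 : ℚ))).extension_property_addMonoidHom
    (QuotientAddGroup.kerLift h) (QuotientAddGroup.kerLift_injective h)
    (QuotientAddGroup.lift h.ker c hc)
  refine ⟨c', ?_⟩
  ext x
  exact DFunLike.congr_fun hc' (QuotientAddGroup.mk x)

/-- The character dual `Hom_ℤ(A, ℚ / ℤ)` of a right `S`-module `A`. -/
def CharDual (S : Type u) [Ring S] (A : Type u) [AddCommGroup A] [Module Sᵐᵒᵖ A] : Type u :=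
  A →+ AddCircle (1 : ℚ)

namespace CharDual

open NTensor

variable {S : Type u} [Ring S]
variable {A B C : Type u} [AddCommGroup A] [Module Sᵐᵒᵖ A] [AddCommGroup B] [Module Sᵐᵒᵖ B]
  [AddCommGroup C] [Module Sᵐᵒᵖ C]
variable {M M' : Type u} [AddCommGroup M] [Module S M] [AddCommGroup M'] [Module S M']

noncomputable instance : AddCommGroup (CharDual S A) :=
  inferInstanceAs (AddCommGroup (A →+ AddCircle (1 : ℚ)))

instance : FunLike (CharDual S A) A (AddCircle (1 : ℚ)) :=
  inferInstanceAs (FunLike (A →+ AddCircle (1 : ℚ)) A (AddCircle (1 : ℚ)))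

instance : AddMonoidHomClass (CharDual S A) A (AddCircle (1 : ℚ)) :=
  inferInstanceAs (AddMonoidHomClass (A →+ AddCircle (1 : ℚ)) A (AddCircle (1 : ℚ)))

@[ext]
theorem ext {c c' : CharDual S A} (h : ∀ a, c a = c' a) : c = c' :=
  DFunLike.ext _ _ h

@[simp]
theorem add_apply (c c' : CharDual S A) (a : A) : (c + c') a = c a + c' a := rfl

@[simp]
theorem zero_apply (a : A) : (0 : CharDual S A) a = 0 := rfl

noncomputable instance : Module S (CharDual S A) where
  smul r c := AddMonoidHom.comp c (DistribSMul.toAddMonoidHom A (op r))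
  one_smul c := by
    ext a
    exact congrArg c (one_smul Sᵐᵒᵖ a)
  mul_smul r s c := by
    ext a
    exact congrArg c (mul_smul (op s) (op r) a)
  smul_zero r := rfl
  smul_add r c c' := rfl
  add_smul r s c := by
    ext a
    exact (congrArg c (add_smul (op r) (op s) a)).trans (map_add c _ _)
  zero_smul c := by
    ext a
    exact (congrArg c (zero_smul Sᵐᵒᵖ a)).trans (map_zero c)

@[simp]
theorem smul_apply (r : S) (c : CharDual S A) (a : A) : (r • c) a = c (op r • a) := rfl

/-- The map of character duals induced by a map of right modules. -/
noncomputable def map (f : A →ₗ[Sᵐᵒᵖ] B) : CharDual S B →ₗ[S] CharDual S A where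
  toFun c := AddMonoidHom.comp c f.toAddMonoidHom
  map_add' _ _ := rfl
  map_smul' r c := by
    ext a
    exact congrArg c (f.map_smul (op r) a).symm

@[simp]
theorem map_apply (f : A →ₗ[Sᵐᵒᵖ] B) (c : CharDual S B) (a : A) : map f c a = c (f a) := rfl

theorem map_surjective {f : A →ₗ[Sᵐᵒᵖ] B} (hf : Function.Injective f) :
    Function.Surjective (map f) := fun c =>
  exists_character_comp_eq f.toAddMonoidHom c fun x hx => by
    rw [(injective_iff_map_eq_zero f).1 hf x hx]
    exact map_zero c

theorem map_injective {f : A →ₗ[Sᵐᵒᵖ] B} (hf : Function.Surjective f) :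
    Function.Injective (map f) := fun c c' h => by
  ext b
  obtain ⟨a, rfl⟩ := hf b
  exact DFunLike.congr_fun h a

theorem map_exact {f : A →ₗ[Sᵐᵒᵖ] B} {g : B →ₗ[Sᵐᵒᵖ] C} (h : Function.Exact f g) :
    Function.Exact (map g) (map f) := by
  intro c
  constructor
  · intro hc
    refine exists_character_comp_eq g.toAddMonoidHom c fun x hx => ?_
    obtain ⟨a, rfl⟩ := (h x).1 hx
    exact DFunLike.congr_fun hc a
  · rintro ⟨c, rfl⟩
    ext a
    simp [h.apply_apply_eq_zero]

/-- The character of `A ⊗_S M` corresponding to an `S`-linear map `M → Hom_ℤ(A, ℚ / ℤ)`. -/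
noncomputable def uncurry (φ : M →ₗ[S] CharDual S A) : NTensor S A M →+ AddCircle (1 : ℚ) :=
  QuotientAddGroup.lift (tensorRels S A M) (FreeAbelianGroup.lift fun p => φ p.2 p.1) (by
    refine (AddSubgroup.closure_le _).2 ?_
    rintro x (⟨a₁, a₂, m, rfl⟩ | ⟨a, m₁, m₂, rfl⟩ | ⟨a, r, m, rfl⟩) <;>
      simp [AddMonoidHom.mem_ker])

@[simp]
theorem uncurry_tmul (φ : M →ₗ[S] CharDual S A) (a : A) (m : M) :
    uncurry φ (tmul a m) = φ m a :=
  FreeAbelianGroup.lift_apply_of _ _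

/-- The `S`-linear map `M → Hom_ℤ(A, ℚ / ℤ)` corresponding to a character of `A ⊗_S M`. -/
noncomputable def curry (c : NTensor S A M →+ AddCircle (1 : ℚ)) : M →ₗ[S] CharDual S A where
  toFun m := AddMonoidHom.mk' (fun a => c (tmul a m)) fun a a' => by rw [add_tmul, map_add]
  map_add' m m' := by
    ext a
    exact (congrArg c (tmul_add a m m')).trans (map_add c _ _)
  map_smul' r m := by
    ext a
    exact congrArg c (smul_tmul r a m).symm

@[simp]
theorem curry_apply (c : NTensor S A M →+ AddCircle (1 : ℚ)) (m : M) (a : A) :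
    curry c m a = c (tmul a m) := rfl

/-- If `A ⊗_S −` keeps `M → M' → M''` exact, then so does `Hom_S(−, Hom_ℤ(A, ℚ / ℤ))`. -/
theorem exists_comp_eq_of_exact_rmap {M'' : Type u} [AddCommGroup M''] [Module S M'']
    {f : M →ₗ[S] M'} {g : M' →ₗ[S] M''}
    (h : Function.Exact (NTensor.rmap A f) (NTensor.rmap A g))
    (φ : M' →ₗ[S] CharDual S A) (hφ : φ ∘ₗ f = 0) : ∃ ψ : M'' →ₗ[S] CharDual S A, ψ ∘ₗ g = φ := by
  have hz : (uncurry φ).comp (NTensor.rmap A f) = 0 := addHom_ext fun a m => by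
    simpa using DFunLike.congr_fun (LinearMap.congr_fun hφ m) a
  obtain ⟨c, hc⟩ := exists_character_comp_eq (NTensor.rmap A g) (uncurry φ) fun x hx => by
    obtain ⟨y, rfl⟩ := (h x).1 hx
    exact DFunLike.congr_fun hz y
  refine ⟨curry c, ?_⟩
  ext m a
  simpa using DFunLike.congr_fun hc (tmul a m)

/-- `M` is flat iff `Hom_S(M, −)` preserves surjectivity of the maps of character duals induced by
injective maps of right modules. -/
theorem isFlatMod_iff (M : ModuleCat.{u} S) : IsFlatMod S M ↔
    ∀ (A B : Type u) [AddCommGroup A] [Module Sᵐᵒᵖ A] [AddCommGroup B] [Module Sᵐᵒᵖ B]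
      (f : A →ₗ[Sᵐᵒᵖ] B), Function.Injective f → ∀ φ : M →ₗ[S] CharDual S A,
        ∃ ψ : M →ₗ[S] CharDual S B, map f ∘ₗ ψ = φ := by
  constructor
  · intro h A B _ _ _ _ f hf φ
    obtain ⟨c, hc⟩ := exists_character_comp_eq (NTensor.lmap M f) (uncurry φ) fun x hx => by
      rw [(injective_iff_map_eq_zero _).1 (h A B f hf) x hx, map_zero]
    refine ⟨curry c, ?_⟩
    ext m a
    simpa using DFunLike.congr_fun hc (tmul a m)
  · intro h A B _ _ _ _ f hf
    refine (injective_iff_map_eq_zero _).2 fun x hx =>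
      CharacterModule.eq_zero_of_character_apply fun c => ?_
    let c' : NTensor S A M →+ AddCircle (1 : ℚ) := c
    obtain ⟨ψ, hψ⟩ := h A B f hf (curry c')
    have hc : (uncurry ψ).comp (NTensor.lmap M f) = c' := addHom_ext fun a m => by
      simpa using DFunLike.congr_fun (LinearMap.congr_fun hψ m) a
    change c' x = 0
    rw [← hc, AddMonoidHom.comp_apply, hx, map_zero]

/-- The character dual of a free right module is injective. -/
theorem injective_of_finsupp (X : Type u) : Module.Injective S (CharDual S (X →₀ Sᵐᵒᵖ)) where
  out K M _ _ _ _ i hi φ := by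
    have hext (x : X) : ∃ ψ : M →+ AddCircle (1 : ℚ),
        ∀ k, ψ (i k) = φ k (Finsupp.single x 1) := by
      obtain ⟨ψ, hψ⟩ := exists_character_comp_eq i.toAddMonoidHom
        (AddMonoidHom.mk' (fun k => φ k (Finsupp.single x 1)) fun a b => by simp)
        fun k hk => by
          rw [(injective_iff_map_eq_zero i).1 hi k hk, map_zero]
      exact ⟨ψ, fun k => DFunLike.congr_fun hψ k⟩
    choose ψ hψ using hext
    let Φ (m : M) : CharDual S (X →₀ Sᵐᵒᵖ) := Finsupp.liftAddHom fun x =>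
      AddMonoidHom.mk' (fun r : Sᵐᵒᵖ => ψ x (unop r • m)) fun r s => by simp [add_smul]
    have hΦ (m : M) (x : X) (r : Sᵐᵒᵖ) : Φ m (Finsupp.single x r) = ψ x (unop r • m) :=
      Finsupp.liftAddHom_apply_single _ _ _
    have hΦ_ext {c c' : CharDual S (X →₀ Sᵐᵒᵖ)}
        (h : ∀ x r, c (Finsupp.single x r) = c' (Finsupp.single x r)) : c = c' :=
      Finsupp.addHom_ext h
    refine ⟨{ toFun := Φ, map_add' := fun m m' => hΦ_ext fun x r => ?_,
              map_smul' := fun s m => hΦ_ext fun x r => ?_ }, fun k => hΦ_ext fun x r => ?_⟩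
    · rw [add_apply, hΦ, hΦ, hΦ, smul_add, map_add]
    · rw [RingHom.id_apply, smul_apply, Finsupp.smul_single, hΦ, hΦ, smul_smul]
      simp
    · change Φ (i k) _ = _
      rw [hΦ, ← map_smul, hψ, map_smul, smul_apply]
      simp

end CharDual

end CharacterDual

section ExtVanishing

variable {S : Type u} [Ring S]

/-- `Ext^i_S(M, N) = 0` for all `i > n`. -/
def ExtVanishesAbove (n : ℕ) (M N : ModuleCat.{u} S) : Prop :=
  ∀ i, n < i → ∀ x : Ext M N i, x = 0

variable {K F M N N₁ N₂ N₃ : ModuleCat.{u} S}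

theorem ExtVanishesAbove.mono {m n : ℕ} (h : ExtVanishesAbove m M N) (hmn : m ≤ n) :
    ExtVanishesAbove n M N :=
  fun i hi => h i (hmn.trans_lt hi)

theorem shortExact_mk_ofHom {f : K →ₗ[S] F} {g : F →ₗ[S] M} (hf : Function.Injective f)
    (hg : Function.Surjective g) (h : Function.Exact f g) :
    (ShortComplex.mk (ModuleCat.ofHom f) (ModuleCat.ofHom g)
      (by ext x; exact h.apply_apply_eq_zero x)).ShortExact :=
  ModuleCat.shortComplex_shortExact _ h hf hg

theorem ExtVanishesAbove.of_quotient {n : ℕ} {f : K →ₗ[S] F} {g : F →ₗ[S] M}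
    (hf : Function.Injective f) (hg : Function.Surjective g) (h : Function.Exact f g)
    (hK : ExtVanishesAbove n K N) (hF : ExtVanishesAbove 0 F N) :
    ExtVanishesAbove (n + 1) M N := by
  intro i hi x
  obtain ⟨j, rfl⟩ := Nat.exists_eq_add_of_lt (Nat.zero_lt_of_lt hi)
  obtain ⟨y, rfl⟩ := Ext.contravariant_sequence_exact₃ (shortExact_mk_ofHom hf hg h) N x
    (hF _ (by lia) _) (n₀ := j) (by lia)
  rw [hK j (by lia) y, Ext.comp_zero]

theorem ExtVanishesAbove.of_kernel {n : ℕ} {f : K →ₗ[S] F} {g : F →ₗ[S] M}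
    (hf : Function.Injective f) (hg : Function.Surjective g) (h : Function.Exact f g)
    (hM : ExtVanishesAbove (n + 1) M N) (hF : ExtVanishesAbove 0 F N) :
    ExtVanishesAbove n K N := by
  intro i hi x
  obtain ⟨y, rfl⟩ := Ext.contravariant_sequence_exact₁ (shortExact_mk_ofHom hf hg h) N x rfl
    (hM _ (by lia) _)
  rw [hF i (by lia) y, Ext.comp_zero]

theorem ext_one_eq_zero_of_extension {f : K →ₗ[S] F} {g : F →ₗ[S] M}
    (hf : Function.Injective f) (hg : Function.Surjective g) (h : Function.Exact f g)
    (hF : ∀ x : Ext F N 1, x = 0) (hext : ∀ φ : K →ₗ[S] N, ∃ ψ : F →ₗ[S] N, ψ ∘ₗ f = φ)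
    (x : Ext M N 1) : x = 0 := by
  obtain ⟨y, rfl⟩ := Ext.contravariant_sequence_exact₃ (shortExact_mk_ofHom hf hg h) N x
    (hF _) (n₀ := 0) rfl
  obtain ⟨φ, rfl⟩ := (Ext.mk₀_bijective _ _).2 y
  obtain ⟨ψ, hψ⟩ := hext φ.hom
  have hφ : φ = ModuleCat.ofHom f ≫ ModuleCat.ofHom ψ := by
    ext k
    exact (LinearMap.congr_fun hψ k).symm
  rw [hφ, ← Ext.mk₀_comp_mk₀]
  exact (shortExact_mk_ofHom hf hg h).extClass_comp_assoc _

theorem ext_one_eq_zero_of_lift {f : N₁ →ₗ[S] N₂} {g : N₂ →ₗ[S] N₃}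
    (hf : Function.Injective f) (hg : Function.Surjective g) (h : Function.Exact f g)
    (hN : ∀ x : Ext M N₂ 1, x = 0) (hlift : ∀ φ : M →ₗ[S] N₃, ∃ ψ : M →ₗ[S] N₂, g ∘ₗ ψ = φ)
    (x : Ext M N₁ 1) : x = 0 := by
  obtain ⟨y, rfl⟩ := Ext.covariant_sequence_exact₁ M (shortExact_mk_ofHom hf hg h) x
    (hN _) (n₀ := 0) rfl
  obtain ⟨φ, rfl⟩ := (Ext.mk₀_bijective _ _).2 y
  obtain ⟨ψ, hψ⟩ := hlift φ.hom
  have hφ : φ = ModuleCat.ofHom ψ ≫ ModuleCat.ofHom g := by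
    ext k
    exact (LinearMap.congr_fun hψ k).symm
  rw [hφ, ← Ext.mk₀_comp_mk₀]
  rw [Ext.comp_assoc_of_second_deg_zero, (shortExact_mk_ofHom hf hg h).comp_extClass,
    Ext.comp_zero]

theorem ext_succ_eq_zero_of_shortExact {i : ℕ} {f : N₁ →ₗ[S] N₂} {g : N₂ →ₗ[S] N₃}
    (hf : Function.Injective f) (hg : Function.Surjective g) (h : Function.Exact f g)
    (h₂ : ∀ x : Ext M N₂ (i + 1), x = 0) (h₃ : ∀ x : Ext M N₃ i, x = 0)
    (x : Ext M N₁ (i + 1)) : x = 0 := by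
  obtain ⟨y, rfl⟩ := Ext.covariant_sequence_exact₁ M (shortExact_mk_ofHom hf hg h) x (h₂ _) rfl
  rw [h₃ y, Ext.zero_comp]

theorem ext_eq_zero_of_shortExact {i : ℕ} {f : N₁ →ₗ[S] N₂} {g : N₂ →ₗ[S] N₃}
    (hf : Function.Injective f) (hg : Function.Surjective g) (h : Function.Exact f g)
    (h₁ : ∀ x : Ext M N₁ (i + 1), x = 0) (h₂ : ∀ x : Ext M N₂ i, x = 0)
    (x : Ext M N₃ i) : x = 0 := by
  obtain ⟨y, rfl⟩ := Ext.covariant_sequence_exact₃ M (shortExact_mk_ofHom hf hg h) x rfl (h₁ _)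
  rw [h₂ y, Ext.zero_comp]

theorem exists_lift_of_ext_one_eq_zero {f : N₁ →ₗ[S] N₂} {g : N₂ →ₗ[S] N₃}
    (hf : Function.Injective f) (hg : Function.Surjective g) (h : Function.Exact f g)
    (hN : ∀ x : Ext M N₁ 1, x = 0) (φ : M →ₗ[S] N₃) : ∃ ψ : M →ₗ[S] N₂, g ∘ₗ ψ = φ := by
  obtain ⟨y, hy⟩ := Ext.covariant_sequence_exact₃ M (shortExact_mk_ofHom hf hg h)
    (Ext.mk₀ (ModuleCat.ofHom φ)) rfl (hN _)
  obtain ⟨ψ, rfl⟩ := (Ext.mk₀_bijective _ _).2 y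
  rw [Ext.mk₀_comp_mk₀] at hy
  have := (Ext.mk₀_bijective _ _).1 hy
  exact ⟨ψ.hom, congrArg ModuleCat.Hom.hom this⟩

end ExtVanishing

section FlatDimension

variable {S : Type u} [Ring S]

/-- `Ext^i_S(M, Hom_ℤ(A, ℚ / ℤ)) = 0` for all `i > n`; equivalently `Tor_i^S(A, M) = 0` for
all `i > n`. -/
def TorVanishesAbove (n : ℕ) (M : ModuleCat.{u} S) (A : Type u) [AddCommGroup A]
    [Module Sᵐᵒᵖ A] : Prop :=
  ExtVanishesAbove n M (ModuleCat.of S (CharDual S A))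

theorem IsFlatMod.torVanishesAbove {M : ModuleCat.{u} S} (hM : IsFlatMod S M) (A : Type u)
    [AddCommGroup A] [Module Sᵐᵒᵖ A] : TorVanishesAbove 0 M A := by
  rintro (_ | i) hi
  · lia
  clear hi
  induction i generalizing A with
  | zero =>
    let p := Finsupp.linearCombination Sᵐᵒᵖ (id : A → A)
    have hp : Function.Surjective p := Finsupp.linearCombination_id_surjective _ _
    have := Module.injective_object_of_injective_module S _
      (inj := CharDual.injective_of_finsupp (S := S) A)
    exact ext_one_eq_zero_of_lift (N₁ := ModuleCat.of S (CharDual S A))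
      (N₂ := ModuleCat.of S (CharDual S (A →₀ Sᵐᵒᵖ)))
      (N₃ := ModuleCat.of S (CharDual S (LinearMap.ker p)))
      (CharDual.map_injective hp)
      (CharDual.map_surjective (LinearMap.ker p).injective_subtype)
      (CharDual.map_exact (LinearMap.exact_subtype_ker_map p)) Ext.eq_zero_of_injective
      ((CharDual.isFlatMod_iff M).1 hM _ _ _ (LinearMap.ker p).injective_subtype)
  | succ i ih =>
    let p := Finsupp.linearCombination Sᵐᵒᵖ (id : A → A)
    have hp : Function.Surjective p := Finsupp.linearCombination_id_surjective _ _
    have := Module.injective_object_of_injective_module S _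
      (inj := CharDual.injective_of_finsupp (S := S) A)
    exact ext_succ_eq_zero_of_shortExact (N₁ := ModuleCat.of S (CharDual S A))
      (N₂ := ModuleCat.of S (CharDual S (A →₀ Sᵐᵒᵖ)))
      (N₃ := ModuleCat.of S (CharDual S (LinearMap.ker p)))
      (CharDual.map_injective hp)
      (CharDual.map_surjective (LinearMap.ker p).injective_subtype)
      (CharDual.map_exact (LinearMap.exact_subtype_ker_map p)) Ext.eq_zero_of_injective (ih _)

theorem isFlatMod_of_torVanishesAbove {M : ModuleCat.{u} S}
    (h : ∀ (A : Type u) [AddCommGroup A] [Module Sᵐᵒᵖ A], TorVanishesAbove 0 M A) :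
    IsFlatMod S M := by
  refine (CharDual.isFlatMod_iff M).2 fun A B _ _ _ _ f hf φ => ?_
  exact exists_lift_of_ext_one_eq_zero
    (N₁ := ModuleCat.of S (CharDual S (B ⧸ LinearMap.range f)))
    (N₂ := ModuleCat.of S (CharDual S B)) (N₃ := ModuleCat.of S (CharDual S A))
    (CharDual.map_injective (LinearMap.range f).mkQ_surjective) (CharDual.map_surjective hf)
    (CharDual.map_exact f.exact_map_mkQ_range) (h _ 1 zero_lt_one) φ

theorem IsGorensteinFlat.torVanishesAbove {M : ModuleCat.{u} S} (hM : IsGorensteinFlat S M)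
    (I : Type u) [AddCommGroup I] [Module Sᵐᵒᵖ I] (hI : Module.Injective Sᵐᵒᵖ I) :
    TorVanishesAbove 0 M I := by
  obtain ⟨F, d, hF, hd, ⟨e⟩, hex⟩ := hM
  have hexact (n : ℤ) : Function.Exact (LinearMap.range (d n)).subtype
      (d (n + 1)).rangeRestrict := fun x => by
    rw [Submodule.coe_subtype, Subtype.range_coe, ← ZeroMemClass.coe_eq_zero]
    exact hd n x
  have key (i : ℕ) : ∀ (n : ℤ) (x : Ext (ModuleCat.of S (LinearMap.range (d n)))
      (ModuleCat.of S (CharDual S I)) (i + 1)), x = 0 := by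
    induction i with
    | zero =>
      intro n
      obtain ⟨n, rfl⟩ : ∃ k, n = k + 1 + 1 := ⟨n - 2, by lia⟩
      refine ext_one_eq_zero_of_extension (K := ModuleCat.of S (LinearMap.range (d (n + 1))))
        (F := F (n + 1 + 1)) (M := ModuleCat.of S (LinearMap.range (d (n + 1 + 1))))
        (LinearMap.range (d (n + 1))).injective_subtype
        (d (n + 1 + 1)).surjective_rangeRestrict (hexact _)
        ((hF _).torVanishesAbove I 1 zero_lt_one) fun φ => ?_
      have hφ : (φ ∘ₗ (d (n + 1)).rangeRestrict) ∘ₗ d n = 0 := by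
        ext1 x
        have hx : (d (n + 1)).rangeRestrict (d n x) = 0 :=
          Subtype.ext ((hd n).apply_apply_eq_zero x)
        exact (congrArg φ hx).trans (map_zero φ)
      obtain ⟨ψ, hψ⟩ := CharDual.exists_comp_eq_of_exact_rmap (hex I hI n) _ hφ
      refine ⟨ψ, ?_⟩
      ext1 ⟨_, y, rfl⟩
      exact LinearMap.congr_fun hψ y
    | succ i ih =>
      intro n x
      obtain ⟨n, rfl⟩ : ∃ k, n = k + 1 := ⟨n - 1, by lia⟩
      obtain ⟨y, rfl⟩ := Ext.contravariant_sequence_exact₃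
        (shortExact_mk_ofHom (K := ModuleCat.of S (LinearMap.range (d n))) (F := F (n + 1))
          (M := ModuleCat.of S (LinearMap.range (d (n + 1))))
          (LinearMap.range (d n)).injective_subtype
          (d (n + 1)).surjective_rangeRestrict (hexact n)) _ x
        ((hF _).torVanishesAbove I _ (by lia) _) (n₀ := i + 1) (by lia)
      rw [ih n y, Ext.comp_zero]
  rintro (_ | i) hi x
  · lia
  let e' : M ≅ ModuleCat.of S (LinearMap.range (d 0)) := e.toModuleIso
  have hx : x = (Ext.mk₀ e'.hom).comp ((Ext.mk₀ e'.inv).comp x (zero_add _)) (zero_add _) := by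
    simp
  rw [hx, key i 0 ((Ext.mk₀ e'.inv).comp x (zero_add _)), Ext.comp_zero]

theorem flatDimLE_iff {n : ℕ} {M : ModuleCat.{u} S} : flatDimLE S n M ↔
    ∀ (A : Type u) [AddCommGroup A] [Module Sᵐᵒᵖ A], TorVanishesAbove n M A := by
  induction n generalizing M with
  | zero => exact ⟨fun h A _ _ => IsFlatMod.torVanishesAbove h A, isFlatMod_of_torVanishesAbove⟩
  | succ n ih =>
    constructor
    · rintro ⟨K, F, ι, π, hι, hπ, hex, hF, hK⟩ A _ _
      exact ExtVanishesAbove.of_quotient hι hπ hex (ih.1 hK A) (hF.torVanishesAbove A)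
    · intro h
      let π := Finsupp.linearCombination S (id : M → M)
      have hπ : Function.Surjective π := Finsupp.linearCombination_id_surjective _ _
      have hF : IsFlatMod S (ModuleCat.of S (M →₀ S)) :=
        isFlatMod_of_torVanishesAbove fun A _ _ => by
          rintro (_ | i) hi x
          · lia
          · exact Ext.eq_zero_of_projective x
      exact ⟨ModuleCat.of S (LinearMap.ker π), ModuleCat.of S (M →₀ S), _, π,
        (LinearMap.ker π).injective_subtype, hπ, LinearMap.exact_subtype_ker_map π, hF,
        ih.2 fun A _ _ => ExtVanishesAbove.of_kernel (LinearMap.ker π).injective_subtype hπ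
          (LinearMap.exact_subtype_ker_map π) (h A) (hF.torVanishesAbove A)⟩

theorem gflatDimLE.torVanishesAbove {n : ℕ} {M : ModuleCat.{u} S} (hM : gflatDimLE S n M)
    (I : Type u) [AddCommGroup I] [Module Sᵐᵒᵖ I] (hI : Module.Injective Sᵐᵒᵖ I) :
    TorVanishesAbove n M I := by
  induction n generalizing M with
  | zero => exact IsGorensteinFlat.torVanishesAbove hM I hI
  | succ n ih =>
    obtain ⟨K, G, ι, π, hι, hπ, hex, hG, hK⟩ := hM
    exact ExtVanishesAbove.of_quotient hι hπ hex (ih hK) (hG.torVanishesAbove I hI)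

theorem exists_injective_embedding (A : Type u) [AddCommGroup A] [Module Sᵐᵒᵖ A] :
    ∃ (I : ModuleCat.{u} Sᵐᵒᵖ) (f : A →ₗ[Sᵐᵒᵖ] I), Module.Injective Sᵐᵒᵖ I ∧
      Function.Injective f := by
  obtain ⟨I, hI, f, hf⟩ := (EnoughInjectives.presentation (ModuleCat.of Sᵐᵒᵖ A)).some
  exact ⟨I, f.hom, (Module.injective_iff_injective_object _ _).2 hI,
    (ModuleCat.mono_iff_injective f).1 hf⟩

/-- Over any ring, the flat dimension of a module of finite flat dimension is at most its
Gorenstein flat dimension. -/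
theorem flatDimLE_of_gflatDimLE {m n : ℕ} {M : ModuleCat.{u} S} (hn : flatDimLE S n M)
    (hm : gflatDimLE S m M) : flatDimLE S m M := by
  rcases le_total n m with hnm | hmn
  · exact flatDimLE_iff.2 fun A _ _ => (flatDimLE_iff.1 hn A).mono hnm
  induction n, hmn using Nat.le_induction with
  | base => exact hn
  | succ k hk ih =>
    refine ih (flatDimLE_iff.2 fun A _ _ i hi x => ?_)
    obtain ⟨I, f, hI, hf⟩ := exists_injective_embedding (S := S) A
    exact ext_eq_zero_of_shortExact
      (N₁ := ModuleCat.of S (CharDual S (I ⧸ LinearMap.range f)))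
      (N₂ := ModuleCat.of S (CharDual S I)) (N₃ := ModuleCat.of S (CharDual S A))
      (CharDual.map_injective (LinearMap.range f).mkQ_surjective) (CharDual.map_surjective hf)
      (CharDual.map_exact f.exact_map_mkQ_range)
      (flatDimLE_iff.1 hn _ _ (by lia)) (hm.torVanishesAbove I hI i (by lia)) x

theorem IsFlatMod.isGorensteinFlat {M : ModuleCat.{u} S} (hM : IsFlatMod S M) :
    IsGorensteinFlat S M := by
  let d (n : ℤ) : M →ₗ[S] M := if Even n then LinearMap.id else 0
  have hid (I : Type u) [AddCommGroup I] [Module Sᵐᵒᵖ I] :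
      NTensor.rmap I (LinearMap.id : M →ₗ[S] M) = AddMonoidHom.id _ :=
    NTensor.addHom_ext fun a m => by simp
  have hzero (I : Type u) [AddCommGroup I] [Module Sᵐᵒᵖ I] :
      NTensor.rmap I (0 : M →ₗ[S] M) = 0 :=
    NTensor.addHom_ext fun a m => by simp [NTensor.tmul_zero]
  have hcases (n : ℤ) :
      d n = LinearMap.id ∧ d (n + 1) = 0 ∨ d n = 0 ∧ d (n + 1) = LinearMap.id := by
    by_cases hn : Even n <;> simp [d, hn, -Int.not_even_iff_odd]
  refine ⟨fun _ => M, d, fun _ => hM, fun n => ?_, ⟨?_⟩, fun I _ _ _ n => ?_⟩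
  · rcases hcases n with ⟨h, h'⟩ | ⟨h, h'⟩ <;> rw [h, h'] <;> intro x <;> simp [eq_comm]
  · exact (LinearEquiv.ofEq _ _ (by simp [d])).trans Submodule.topEquiv |>.symm
  · rcases hcases n with ⟨h, h'⟩ | ⟨h, h'⟩ <;> rw [h, h', hid, hzero] <;> intro x <;>
      simp [eq_comm]

theorem flatDimLE.gflatDimLE {n : ℕ} {M : ModuleCat.{u} S} (h : flatDimLE S n M) :
    gflatDimLE S n M := by
  induction n generalizing M with
  | zero => exact IsFlatMod.isGorensteinFlat h
  | succ n ih =>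
    obtain ⟨K, F, ι, π, hι, hπ, hex, hF, hK⟩ := h
    exact ⟨K, F, ι, π, hι, hπ, hex, hF.isGorensteinFlat, ih hK⟩

theorem exists_flatDimLE_of_flatDim_ne_top {M : ModuleCat.{u} S} (h : flatDim S M ≠ ⊤) :
    ∃ n, flatDimLE S n M := by
  by_contra! hn
  exact h (sInf_eq_top.2 fun d ⟨n, _, hd⟩ => absurd hd (hn n))

theorem gflatDim_eq_flatDim {M : ModuleCat.{u} S} (h : flatDim S M ≠ ⊤) :
    gflatDim S M = flatDim S M := by
  obtain ⟨k, hk⟩ := exists_flatDimLE_of_flatDim_ne_top h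
  have (n : ℕ) : gflatDimLE S n M ↔ flatDimLE S n M :=
    ⟨flatDimLE_of_gflatDimLE hk, flatDimLE.gflatDimLE⟩
  simp only [gflatDim, flatDim, this]

theorem finitisticFlatDim_le (S : Type u) [Ring S] :
    finitisticFlatDim S ≤ finitisticGFlatDim S := by
  refine sSup_le_sSup ?_
  rintro d ⟨hd, M, rfl⟩
  exact ⟨hd, M, gflatDim_eq_flatDim hd⟩

end FlatDimension

/-- **Proposition 2.7 (first part).**  For any ring `R`, `l.FFD(R) ≤ l.FGFD(R)` and
`r.FFD(R) ≤ r.FGFD(R)`. -/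
theorem finitisticFlatDim_le_finitisticGFlatDim (R : Type u) [Ring R] :
    finitisticFlatDim R ≤ finitisticGFlatDim R ∧
    finitisticFlatDim Rᵐᵒᵖ ≤ finitisticGFlatDim Rᵐᵒᵖ := by
  exact ⟨finitisticFlatDim_le R, finitisticFlatDim_le Rᵐᵒᵖ⟩
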